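/- Let a = x₀ < ⋯ < x_n = b, c = y₀ < ⋯ < y_m = d with n, m ≥ 2, let z_{k,l} ∈ ℝ, and let g_{k,l} ∈ (0,1) for k ∈ {1,…,n}, l ∈ {1,…,m}. Define the coefficients a_k, b_k, c_l, d_l, e_{k,l}, f_{k,l}, α_{k,l}, β_{k,l} from the data by the fractal interpolation surface formulas, let δ = max{|a|,|b|,|c|,|d|}, let θ = min{θ₁, θ₂} with θ₁, θ₂ defined from the coefficients as in the construction, and equip X = I × J × ℝ (I = [a,b], J = [c,d]) with the metric ρ((x,y,z),(x',y',z')) = |x−x'| + |y−y'| + θ|z−z'|. Let F_{k,l}(x,y,z) = (a_k x + b_k, c_l y + d_l, e_{k,l}x + f_{k,l}y + g_{k,l}z + α_{k,l}xy + β_{k,l}), with contraction constants C_{k,l} = max{ a_k + θ(|e_{k,l}| + δ|α_{k,l}|), c_l + θ(|f_{k,l}| + δ|α_{k,l}|), g_{k,l} } < 1 and fixed points γ_{k,l}. Set M = max over all index pairs of ρ(γ_{i,j}, γ_{k,l}), let (k', l') be an index pair with C_{k',l'} maximal and (k'', l'') an index pair different from (k',l') with C_{k'',l''} maximal among the remaining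 pairs. Then the attractor A_𝒮 of the IFS 𝒮 = ((X, ρ), (F_{k,l})_{k,l}) — which equals the graph G_f of the fractal interpolation function f of the data — satisfies G_f ⊆ ( ⋃_{(k,l) ≠ (k',l')} O[γ_{k,l}, M·C_{k,l}·(1 + C_{k',l'})/(1 − C_{k',l'}·C_{k'',l''})] ) ∪ O[γ_{k',l'}, M·C_{k',l'}·(1 + C_{k'',l''})/(1 − C_{k',l'}·C_{k'',l''})], where O[P, r] is the closed ρ-ball (an octahedron) of center P and radius r. -/

import Mathlib

theorem aux_cover {X ι : Type*} (s : Finset ι) (ρ : X → X → ℝ)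
    (tri : ∀ P Q R, ρ P R ≤ ρ P Q + ρ Q R) (G : Set X) (F : ι → X → X) (γ : ι → X)
    (C r : ι → ℝ) (M c : ℝ) (hc0 : 0 ≤ c) (hc1 : c < 1)
    (hC0 : ∀ i ∈ s, 0 ≤ C i) (hCc : ∀ i ∈ s, C i ≤ c) (hr0 : ∀ i ∈ s, 0 ≤ r i)
    (hM : ∀ i ∈ s, ∀ j ∈ s, ρ (γ i) (γ j) ≤ M)
    (hr : ∀ i ∈ s, ∀ j ∈ s, i ≠ j → C i * (r j + M) ≤ r i)
    (bdd : ∃ B, ∀ P ∈ G, ∃ i ∈ s, ρ P (γ i) ≤ B)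
    (lip : ∀ i ∈ s, ∀ P ∈ G, ρ (F i P) (γ i) ≤ C i * ρ P (γ i))
    (self : ∀ P ∈ G, ∃ i ∈ s, ∃ Q ∈ G, F i Q = P) :
    ∀ P ∈ G, ∃ i ∈ s, ρ P (γ i) ≤ r i := by
  obtain ⟨B₀, hB₀⟩ := bdd
  set B := max B₀ 0 with hBdef
  have hB : 0 ≤ B := le_max_right _ _
  have key : ∀ N : ℕ, ∀ P ∈ G, ∃ i ∈ s, ρ P (γ i) ≤ r i + c ^ N * B := by
    intro N
    induction N with
    | zero =>
      intro P hP
      obtain ⟨i, hi, h⟩ := hB₀ P hP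
      refine ⟨i, hi, ?_⟩
      have := hr0 i hi
      have := le_max_left B₀ 0
      simp only [pow_zero, one_mul]
      linarith
    | succ N ih =>
      intro P hP
      obtain ⟨i, hi, Q, hQ, rfl⟩ := self P hP
      obtain ⟨j, hj, h⟩ := ih Q hQ
      refine ⟨i, hi, ?_⟩
      have h1 := lip i hi Q hQ
      have hE : 0 ≤ c ^ N * B := by positivity
      have h2 : C i * (c ^ N * B) ≤ c * (c ^ N * B) :=
        mul_le_mul_of_nonneg_right (hCc i hi) hE
      have h3 : c ^ (N + 1) * B = c * (c ^ N * B) := by ring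
      rw [h3]
      by_cases hij : i = j
      · subst hij
        have h4 := mul_le_mul_of_nonneg_left h (hC0 i hi)
        have h5 : C i * r i ≤ 1 * r i :=
          mul_le_mul_of_nonneg_right ((hCc i hi).trans hc1.le) (hr0 i hi)
        nlinarith
      · have h4 : ρ Q (γ i) ≤ r j + c ^ N * B + M := by
          have := tri Q (γ j) (γ i)
          have := hM j hj i hi
          linarith
        have h5 := mul_le_mul_of_nonneg_left h4 (hC0 i hi)
        have h6 := hr i hi j hj hij
        nlinarith
  intro P hP
  by_contra hcon
  push Not at hcon
  have ht : Filter.Tendsto (fun N : ℕ => c ^ N * B) Filter.atTop (nhds 0) := by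
    simpa using (tendsto_pow_atTop_nhds_zero_of_lt_one hc0 hc1).mul_const B
  have hev : ∀ᶠ N : ℕ in Filter.atTop, ∀ i ∈ s, c ^ N * B < ρ P (γ i) - r i := by
    rw [Filter.eventually_all_finset]
    intro i hi
    exact ht.eventually_lt_const (by linarith [hcon i hi])
  obtain ⟨N, hN⟩ := hev.exists
  obtain ⟨i, hi, h⟩ := key N P hP
  linarith [hN i hi]

theorem aux_mono (n : ℕ) (x : ℕ → ℝ) (hx : ∀ i < n, x i < x (i + 1)) :
    ∀ j, j ≤ n → ∀ i, i ≤ j → x i ≤ x j := by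
  intro j
  induction j with
  | zero => intro _ i hi; obtain rfl : i = 0 := by omega
            exact le_rfl
  | succ j ih =>
    intro hj i hi
    rcases Nat.lt_or_ge i (j + 1) with h | h
    · exact (ih (by omega) i (by omega)).trans (hx j (by omega)).le
    · obtain rfl : i = j + 1 := by omega
      exact le_rfl

theorem aux_coord (n : ℕ) (x : ℕ → ℝ) (hx : ∀ i < n, x i < x (i + 1)) (k : ℕ)
    (h1 : 1 ≤ k) (h2 : k ≤ n) (a b : ℝ) (ha : a = (x k - x (k - 1)) / (x n - x 0))
    (hb : b = (x (k - 1) * x n - x k * x 0) / (x n - x 0)) :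
    0 ≤ a ∧ a ≤ 1 ∧ ∀ p, a < 1 → a * p + b = p → x 0 ≤ p ∧ p ≤ x n := by
  have m1 := aux_mono n x hx (k - 1) (by omega) 0 (by omega)
  have m2 : x (k - 1) < x k := by
    have := hx (k - 1) (by omega)
    rwa [Nat.sub_add_cancel h1] at this
  have m3 := aux_mono n x hx n le_rfl k h2
  have hD : 0 < x n - x 0 := by linarith
  have e1 : a * x 0 + b = x (k - 1) := by rw [ha, hb]; field_simp; ring
  have e2 : a * x n + b = x k := by rw [ha, hb]; field_simp; ring
  refine ⟨?_, ?_, ?_⟩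
  · rw [ha]; exact div_nonneg (by linarith) hD.le
  · rw [ha, div_le_one hD]; linarith
  · intro p hlt hp
    constructor <;> nlinarith

theorem aux_lip (θ δ a c e f g α x y z x' y' z' C : ℝ) (hθ : 0 ≤ θ)
    (ha : 0 ≤ a) (hc : 0 ≤ c) (hg : 0 ≤ g) (hy : |y| ≤ δ) (hx' : |x'| ≤ δ)
    (hC1 : a + θ * (|e| + δ * |α|) ≤ C) (hC2 : c + θ * (|f| + δ * |α|) ≤ C) (hC3 : g ≤ C)
    (b d β : ℝ) :
    |(a * x + b) - (a * x' + b)| + |(c * y + d) - (c * y' + d)|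
      + θ * |(e * x + f * y + g * z + α * (x * y) + β)
          - (e * x' + f * y' + g * z' + α * (x' * y') + β)|
      ≤ C * (|x - x'| + |y - y'| + θ * |z - z'|) := by
  have e1 : |(a * x + b) - (a * x' + b)| = a * |x - x'| := by
    rw [← abs_of_nonneg ha, ← abs_mul, abs_of_nonneg ha]; congr 1; ring
  have e2 : |(c * y + d) - (c * y' + d)| = c * |y - y'| := by
    rw [← abs_of_nonneg hc, ← abs_mul, abs_of_nonneg hc]; congr 1; ring
  have e3 : |(e * x + f * y + g * z + α * (x * y) + β)
          - (e * x' + f * y' + g * z' + α * (x' * y') + β)|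
      ≤ (|e| + δ * |α|) * |x - x'| + (|f| + δ * |α|) * |y - y'| + g * |z - z'| := by
    have : (e * x + f * y + g * z + α * (x * y) + β)
          - (e * x' + f * y' + g * z' + α * (x' * y') + β)
        = (e + y * α) * (x - x') + (f + x' * α) * (y - y') + g * (z - z') := by ring
    rw [this]
    refine (abs_add_three _ _ _).trans ?_
    rw [abs_mul, abs_mul, abs_mul, abs_of_nonneg hg]
    have h1 : |e + y * α| ≤ |e| + δ * |α| := by
      refine (abs_add_le _ _).trans ?_
      rw [abs_mul]
      gcongr
    have h2 : |f + x' * α| ≤ |f| + δ * |α| := by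
      refine (abs_add_le _ _).trans ?_
      rw [abs_mul]
      gcongr
    gcongr
  rw [e1, e2]
  have h3 := mul_le_mul_of_nonneg_left e3 hθ
  have h4 := mul_le_mul_of_nonneg_right hC1 (abs_nonneg (x - x'))
  have h5 := mul_le_mul_of_nonneg_right hC2 (abs_nonneg (y - y'))
  have h6 := mul_le_mul_of_nonneg_right hC3 (mul_nonneg hθ (abs_nonneg (z - z')))
  nlinarith

open scoped Classical in
/-- Main theorem: for the fractal interpolation surface IFS
`𝒮 = ((I × J × ℝ, ρ), (F_{k,l})_{1 ≤ k ≤ n, 1 ≤ l ≤ m})` built from the data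
`a = x₀ < ⋯ < x_n = b`, `c = y₀ < ⋯ < y_m = d`, `z_{k,l}`, with vertical scalings
`g_{k,l} ∈ (0,1)`, coefficients `a_k, b_k, c_l, d_l, e_{k,l}, f_{k,l}, α_{k,l}, β_{k,l}`
given by the interpolation formulas, `δ = max{|a|,|b|,|c|,|d|}`, `θ = min{θ₁,θ₂}`,
metric `ρ(P,Q) = |P₁−Q₁| + |P₂−Q₂| + θ|P₃−Q₃|`, contraction constants
`C_{k,l} = max{a_k + θ(|e_{k,l}| + δ|α_{k,l}|), c_l + θ(|f_{k,l}| + δ|α_{k,l}|), g_{k,l}}`,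
fixed points `γ_{k,l}`, `M = max ρ(γ_{i,j}, γ_{k,l})`, `(k',l')` maximizing `C` and
`(k'',l'') ≠ (k',l')` maximizing `C` among the remaining pairs, the attractor `G` of `𝒮`
(which equals the graph `G_f` of the fractal interpolation function) is contained in
`(⋃_{(k,l) ≠ (k',l')} O[γ_{k,l}, M C_{k,l} (1+C_{k',l'})/(1−C_{k',l'}C_{k'',l''})]) ∪
O[γ_{k',l'}, M C_{k',l'} (1+C_{k'',l''})/(1−C_{k',l'}C_{k'',l''})]`,
where `O[P,r]` is the closed `ρ`-ball of center `P` and radius `r`. -/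
theorem graph_subset_octahedron_cover
    (n m : ℕ) (hn : 2 ≤ n) (hm : 2 ≤ m)
    (x y : ℕ → ℝ) (z : ℕ → ℕ → ℝ)
    (hx : ∀ i < n, x i < x (i + 1)) (hy : ∀ j < m, y j < y (j + 1))
    (g : ℕ → ℕ → ℝ)
    (hg : ∀ k l, 1 ≤ k → k ≤ n → 1 ≤ l → l ≤ m → 0 < g k l ∧ g k l < 1)
    -- the coefficients of the maps `F_{k,l}` of the IFS
    (ak bk : ℕ → ℝ) (cl dl : ℕ → ℝ) (e f α β : ℕ → ℕ → ℝ)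
    (hak : ∀ k, 1 ≤ k → k ≤ n → ak k = (x k - x (k - 1)) / (x n - x 0))
    (hbk : ∀ k, 1 ≤ k → k ≤ n →
      bk k = (x (k - 1) * x n - x k * x 0) / (x n - x 0))
    (hcl : ∀ l, 1 ≤ l → l ≤ m → cl l = (y l - y (l - 1)) / (y m - y 0))
    (hdl : ∀ l, 1 ≤ l → l ≤ m →
      dl l = (y (l - 1) * y m - y l * y 0) / (y m - y 0))
    (hα : ∀ k l, 1 ≤ k → k ≤ n → 1 ≤ l → l ≤ m →
      α k l = ((z k l - g k l * z n m) - (z (k - 1) l - g k l * z 0 m)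
          - (z k (l - 1) - g k l * z n 0) + (z (k - 1) (l - 1) - g k l * z 0 0))
        / ((x n - x 0) * (y m - y 0)))
    (he : ∀ k l, 1 ≤ k → k ≤ n → 1 ≤ l → l ≤ m →
      e k l = (y 0 * ((z (k - 1) l - g k l * z 0 m) - (z k l - g k l * z n m))
          - y m * ((z (k - 1) (l - 1) - g k l * z 0 0) - (z k (l - 1) - g k l * z n 0)))
        / ((x n - x 0) * (y m - y 0)))
    (hf : ∀ k l, 1 ≤ k → k ≤ n → 1 ≤ l → l ≤ m →
      f k l = (x 0 * ((z k (l - 1) - g k l * z n 0) - (z k l - g k l * z n m))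
          - x n * ((z (k - 1) (l - 1) - g k l * z 0 0) - (z (k - 1) l - g k l * z 0 m)))
        / ((x n - x 0) * (y m - y 0)))
    (hβ : ∀ k l, 1 ≤ k → k ≤ n → 1 ≤ l → l ≤ m →
      β k l = (y 0 * (x 0 * (z k l - g k l * z n m) - x n * (z (k - 1) l - g k l * z 0 m))
          - y m * (x 0 * (z k (l - 1) - g k l * z n 0)
            - x n * (z (k - 1) (l - 1) - g k l * z 0 0)))
        / ((x n - x 0) * (y m - y 0)))
    -- `δ = max{|a|,|b|,|c|,|d|}`
    (δ : ℝ) (hδ : δ = max (max |x 0| |x n|) (max |y 0| |y m|))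
    -- the maxima appearing in the definition of `θ₁` and `θ₂`
    (maxA : ℝ) (hmaxA₁ : ∀ k, 1 ≤ k → k ≤ n → ak k ≤ maxA)
    (hmaxA₂ : ∃ k, 1 ≤ k ∧ k ≤ n ∧ ak k = maxA)
    (maxC : ℝ) (hmaxC₁ : ∀ l, 1 ≤ l → l ≤ m → cl l ≤ maxC)
    (hmaxC₂ : ∃ l, 1 ≤ l ∧ l ≤ m ∧ cl l = maxC)
    (maxE : ℝ)
    (hmaxE₁ : ∀ k l, 1 ≤ k → k ≤ n → 1 ≤ l → l ≤ m →
      |e k l| + δ * |α k l| ≤ maxE)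
    (hmaxE₂ : ∃ k l, 1 ≤ k ∧ k ≤ n ∧ 1 ≤ l ∧ l ≤ m ∧
      |e k l| + δ * |α k l| = maxE)
    (maxF : ℝ)
    (hmaxF₁ : ∀ k l, 1 ≤ k → k ≤ n → 1 ≤ l → l ≤ m →
      |f k l| + δ * |α k l| ≤ maxF)
    (hmaxF₂ : ∃ k l, 1 ≤ k ∧ k ≤ n ∧ 1 ≤ l ∧ l ≤ m ∧
      |f k l| + δ * |α k l| = maxF)
    -- `θ₁`, `θ₂` and `θ`
    (θ₁ θ₂ θ : ℝ)
    (hθ₁ : θ₁ = if (∀ k l, 1 ≤ k → k ≤ n → 1 ≤ l → l ≤ m → e k l = 0 ∧ α k l = 0)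
      then 1 else (1 - maxA) / (2 * maxE))
    (hθ₂ : θ₂ = if (∀ k l, 1 ≤ k → k ≤ n → 1 ≤ l → l ≤ m → f k l = 0 ∧ α k l = 0)
      then 1 else (1 - maxC) / (2 * maxF))
    (hθ : θ = min θ₁ θ₂)
    -- the metric `ρ`
    (ρ : (ℝ × ℝ × ℝ) → (ℝ × ℝ × ℝ) → ℝ)
    (hρ : ∀ P Q : ℝ × ℝ × ℝ,
      ρ P Q = |P.1 - Q.1| + |P.2.1 - Q.2.1| + θ * |P.2.2 - Q.2.2|)
    -- the maps `F_{k,l}` of the IFS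
    (F : ℕ → ℕ → (ℝ × ℝ × ℝ) → (ℝ × ℝ × ℝ))
    (hF : ∀ k l, ∀ P : ℝ × ℝ × ℝ,
      F k l P = (ak k * P.1 + bk k, cl l * P.2.1 + dl l,
        e k l * P.1 + f k l * P.2.1 + g k l * P.2.2
          + α k l * (P.1 * P.2.1) + β k l))
    -- the contraction constants `C_{k,l}`
    (C : ℕ → ℕ → ℝ)
    (hCdef : ∀ k l, C k l = max (max (ak k + θ * (|e k l| + δ * |α k l|))
      (cl l + θ * (|f k l| + δ * |α k l|))) (g k l))
    (hC1 : ∀ k l, 1 ≤ k → k ≤ n → 1 ≤ l → l ≤ m → C k l < 1)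
    -- the fixed points `γ_{k,l}`
    (γ : ℕ → ℕ → ℝ × ℝ × ℝ)
    (hγ : ∀ k l, 1 ≤ k → k ≤ n → 1 ≤ l → l ≤ m → F k l (γ k l) = γ k l)
    -- `M = max` of the mutual `ρ`-distances of the fixed points
    (M : ℝ)
    (hM₁ : ∀ i j k l, 1 ≤ i → i ≤ n → 1 ≤ j → j ≤ m → 1 ≤ k → k ≤ n →
      1 ≤ l → l ≤ m → ρ (γ i j) (γ k l) ≤ M)
    (hM₂ : ∃ i j k l, 1 ≤ i ∧ i ≤ n ∧ 1 ≤ j ∧ j ≤ m ∧ 1 ≤ k ∧ k ≤ n ∧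
      1 ≤ l ∧ l ≤ m ∧ ρ (γ i j) (γ k l) = M)
    -- `(k',l')` maximizes `C`, and `(k'',l'') ≠ (k',l')` maximizes `C` among the rest
    (k' l' k'' l'' : ℕ)
    (hk' : 1 ≤ k' ∧ k' ≤ n) (hl' : 1 ≤ l' ∧ l' ≤ m)
    (hk'' : 1 ≤ k'' ∧ k'' ≤ n) (hl'' : 1 ≤ l'' ∧ l'' ≤ m)
    (hne : (k'', l'') ≠ (k', l'))
    (hC' : ∀ k l, 1 ≤ k → k ≤ n → 1 ≤ l → l ≤ m → C k l ≤ C k' l')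
    (hC'' : ∀ k l, 1 ≤ k → k ≤ n → 1 ≤ l → l ≤ m → (k, l) ≠ (k', l') →
      C k l ≤ C k'' l'')
    -- `G` is the attractor of the IFS `𝒮` (= the graph of the interpolation function)
    (G : Set (ℝ × ℝ × ℝ)) (hGcpt : IsCompact G) (hGne : G.Nonempty)
    (hGsub : G ⊆ Set.Icc (x 0) (x n) ×ˢ Set.Icc (y 0) (y m) ×ˢ (Set.univ : Set ℝ))
    (hGself : G = ⋃ k ∈ Set.Icc 1 n, ⋃ l ∈ Set.Icc 1 m, F k l '' G) :
    G ⊆ (⋃ k ∈ Set.Icc 1 n, ⋃ l ∈ Set.Icc 1 m, ⋃ (_ : (k, l) ≠ (k', l')),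
        {Q : ℝ × ℝ × ℝ | ρ Q (γ k l)
          ≤ M * C k l * (1 + C k' l') / (1 - C k' l' * C k'' l'')}) ∪
      {Q : ℝ × ℝ × ℝ | ρ Q (γ k' l')
        ≤ M * C k' l' * (1 + C k'' l'') / (1 - C k' l' * C k'' l'')} := by
  have hA := fun k h1 h2 => aux_coord n x hx k h1 h2 (ak k) (bk k) (hak k h1 h2) (hbk k h1 h2)
  have hCc := fun l h1 h2 => aux_coord m y hy l h1 h2 (cl l) (dl l) (hcl l h1 h2) (hdl l h1 h2)
  have hδ0 : 0 ≤ δ := by rw [hδ]; positivity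
  have hθ0 : 0 ≤ θ := by
    rw [hθ]
    refine le_min ?_ ?_
    · rw [hθ₁]
      split_ifs
      · exact zero_le_one
      · obtain ⟨k, h1, h2, h3⟩ := hmaxA₂
        obtain ⟨i, j, _, _, _, _, h4⟩ := hmaxE₂
        have := (hA k h1 h2).2.1
        refine div_nonneg (by linarith) ?_
        rw [← h4]; positivity
    · rw [hθ₂]
      split_ifs
      · exact zero_le_one
      · obtain ⟨k, h1, h2, h3⟩ := hmaxC₂
        obtain ⟨i, j, _, _, _, _, h4⟩ := hmaxF₂
        have := (hCc k h1 h2).2.1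
        refine div_nonneg (by linarith) ?_
        rw [← h4]; positivity
  have hCa : ∀ k l, ak k + θ * (|e k l| + δ * |α k l|) ≤ C k l := fun k l => by
    rw [hCdef]; exact (le_max_left _ _).trans (le_max_left _ _)
  have hCb : ∀ k l, cl l + θ * (|f k l| + δ * |α k l|) ≤ C k l := fun k l => by
    rw [hCdef]; exact (le_max_right _ _).trans (le_max_left _ _)
  have hCg : ∀ k l, g k l ≤ C k l := fun k l => by
    rw [hCdef]; exact le_max_right _ _
  have hC0 : ∀ k l, 1 ≤ k → k ≤ n → 1 ≤ l → l ≤ m → 0 ≤ C k l := fun k l h1 h2 h3 h4 =>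
    (hg k l h1 h2 h3 h4).1.le.trans (hCg k l)
  have hρ0 : ∀ P Q, 0 ≤ ρ P Q := fun P Q => by rw [hρ]; positivity
  have hM0 : 0 ≤ M := by
    obtain ⟨i, j, k, l, _, _, _, _, _, _, _, _, h⟩ := hM₂
    rw [← h]; exact hρ0 _ _
  have habsx : ∀ p, x 0 ≤ p → p ≤ x n → |p| ≤ δ := fun p h1 h2 => by
    rw [hδ]; exact (abs_le_max_abs_abs h1 h2).trans (le_max_left _ _)
  have habsy : ∀ p, y 0 ≤ p → p ≤ y m → |p| ≤ δ := fun p h1 h2 => by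
    rw [hδ]; exact (abs_le_max_abs_abs h1 h2).trans (le_max_right _ _)
  have tri : ∀ P Q R, ρ P R ≤ ρ P Q + ρ Q R := fun P Q R => by
    rw [hρ, hρ, hρ]
    have h1 := abs_sub_le P.1 Q.1 R.1
    have h2 := abs_sub_le P.2.1 Q.2.1 R.2.1
    have h3 := mul_le_mul_of_nonneg_left (abs_sub_le P.2.2 Q.2.2 R.2.2) hθ0
    linarith
  have hlip : ∀ k l, 1 ≤ k → k ≤ n → 1 ≤ l → l ≤ m → ∀ P ∈ G,
      ρ (F k l P) (γ k l) ≤ C k l * ρ P (γ k l) := by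
    intro k l h1 h2 h3 h4 P hP
    have hfix := hγ k l h1 h2 h3 h4
    have hlt := hC1 k l h1 h2 h3 h4
    have hak1 : ak k < 1 := by
      have := hCa k l
      have : 0 ≤ θ * (|e k l| + δ * |α k l|) := by positivity
      linarith
    have hx' := (hA k h1 h2).2.2 (γ k l).1 hak1
      (by have := congrArg Prod.fst hfix; rwa [hF] at this)
    obtain ⟨-, ⟨hy1, hy2⟩, -⟩ := hGsub hP
    have := aux_lip θ δ (ak k) (cl l) (e k l) (f k l) (g k l) (α k l) P.1 P.2.1 P.2.2
      (γ k l).1 (γ k l).2.1 (γ k l).2.2 (C k l) hθ0 (hA k h1 h2).1 (hCc l h3 h4).1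
      (hg k l h1 h2 h3 h4).1.le (habsy _ hy1 hy2) (habsx _ hx'.1 hx'.2)
      (hCa k l) (hCb k l) (hCg k l) (bk k) (dl l) (β k l)
    calc ρ (F k l P) (γ k l) = ρ (F k l P) (F k l (γ k l)) := by rw [hfix]
      _ ≤ _ := by
        rw [hρ, hρ P, hF, hF]
        exact this
  have h1' := hC0 k' l' hk'.1 hk'.2 hl'.1 hl'.2
  have h2' := hC0 k'' l'' hk''.1 hk''.2 hl''.1 hl''.2
  have h1lt := hC1 k' l' hk'.1 hk'.2 hl'.1 hl'.2
  have h21 := hC' k'' l'' hk''.1 hk''.2 hl''.1 hl''.2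
  set c1 := C k' l' with hc1
  set c2 := C k'' l'' with hc2
  have hD : 0 < 1 - c1 * c2 := by nlinarith
  have main := aux_cover (Finset.Icc 1 n ×ˢ Finset.Icc 1 m) ρ tri G
    (fun p => F p.1 p.2) (fun p => γ p.1 p.2) (fun p => C p.1 p.2)
    (fun p => if p = (k', l') then M * c1 * (1 + c2) / (1 - c1 * c2)
      else M * C p.1 p.2 * (1 + c1) / (1 - c1 * c2)) M c1 h1' h1lt
    ?_ ?_ ?_ ?_ ?_ ?_ ?_ ?_
  · intro P hP
    obtain ⟨⟨k, l⟩, hs, h⟩ := main P hP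
    simp only [Finset.mem_product, Finset.mem_Icc] at hs
    by_cases hp : (k, l) = (k', l')
    · right
      simp only [hp, if_true] at h
      obtain ⟨rfl, rfl⟩ := Prod.mk.inj hp
      exact h
    · left
      simp only [hp, if_false] at h
      simp only [Set.mem_iUnion]
      exact ⟨k, hs.1, l, hs.2, hp, h⟩
  · rintro ⟨k, l⟩ hs
    simp only [Finset.mem_product, Finset.mem_Icc] at hs
    exact hC0 k l hs.1.1 hs.1.2 hs.2.1 hs.2.2
  · rintro ⟨k, l⟩ hs
    simp only [Finset.mem_product, Finset.mem_Icc] at hs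
    exact hC' k l hs.1.1 hs.1.2 hs.2.1 hs.2.2
  · rintro ⟨k, l⟩ hs
    simp only [Finset.mem_product, Finset.mem_Icc] at hs
    have := hC0 k l hs.1.1 hs.1.2 hs.2.1 hs.2.2
    dsimp only
    split_ifs <;> positivity
  · rintro ⟨i, j⟩ hs ⟨k, l⟩ ht
    simp only [Finset.mem_product, Finset.mem_Icc] at hs ht
    exact hM₁ i j k l hs.1.1 hs.1.2 hs.2.1 hs.2.2 ht.1.1 ht.1.2 ht.2.1 ht.2.2
  · rintro ⟨i, j⟩ hs ⟨k, l⟩ ht hij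
    simp only [Finset.mem_product, Finset.mem_Icc] at hs ht
    have q1 := hC0 i j hs.1.1 hs.1.2 hs.2.1 hs.2.2
    have q2 := hC0 k l ht.1.1 ht.1.2 ht.2.1 ht.2.2
    have e1 : M * c1 * (1 + c2) / (1 - c1 * c2) + M = M * (1 + c1) / (1 - c1 * c2) := by
      field_simp; ring
    have e2 : (k, l) ≠ (k', l') →
        M * C k l * (1 + c1) / (1 - c1 * c2) + M ≤ M * (1 + c2) / (1 - c1 * c2) := by
      intro hne'
      have hle := hC'' k l ht.1.1 ht.1.2 ht.2.1 ht.2.2 hne'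
      have : M * (1 + c2) / (1 - c1 * c2) = M * c2 * (1 + c1) / (1 - c1 * c2) + M := by
        rw [div_add' _ _ _ hD.ne']; congr 1; ring
      rw [this]
      gcongr
    dsimp only
    by_cases hi : (i, j) = (k', l')
    · have hk : (k, l) ≠ (k', l') := fun h => hij (hi.trans h.symm)
      rw [if_pos hi, if_neg hk]
      obtain ⟨rfl, rfl⟩ := Prod.mk.inj hi
      refine (mul_le_mul_of_nonneg_left (e2 hk) q1).trans (le_of_eq ?_)
      rw [← hc1]; ring
    · rw [if_neg hi]
      have e3 : M * C i j * (1 + c1) / (1 - c1 * c2)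
          = C i j * (M * (1 + c1) / (1 - c1 * c2)) := by ring
      rw [e3]
      refine mul_le_mul_of_nonneg_left ?_ q1
      by_cases hk : (k, l) = (k', l')
      · rw [if_pos hk]; exact e1.le
      · rw [if_neg hk]
        refine (e2 hk).trans ?_
        gcongr
  · have hcont : ContinuousOn (fun P : ℝ × ℝ × ℝ => ρ P (γ k' l')) G := by
      simp only [hρ]
      fun_prop
    obtain ⟨B, hB⟩ := hGcpt.bddAbove_image hcont
    refine ⟨B, fun P hP => ⟨(k', l'), ?_, hB ⟨P, hP, rfl⟩⟩⟩
    simp only [Finset.mem_product, Finset.mem_Icc]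
    exact ⟨hk', hl'⟩
  · rintro ⟨k, l⟩ hs
    simp only [Finset.mem_product, Finset.mem_Icc] at hs
    exact hlip k l hs.1.1 hs.1.2 hs.2.1 hs.2.2
  · intro P hP
    rw [hGself] at hP
    simp only [Set.mem_iUnion] at hP
    obtain ⟨k, hk, l, hl, Q, hQ, h⟩ := hP
    refine ⟨(k, l), ?_, Q, hQ, h⟩
    simp only [Finset.mem_product, Finset.mem_Icc]
    exact ⟨hk, hl⟩
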